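/- Fix β > 0, δ ∈ (0, 1/2) and a constant c > 1/(1−2δ); for each d ≥ 3, set n_d = ⌈c · log d / log log d⌉. Define Y^f_d = f(S_d)/√d and Y^Q_d = Q̃_{n_d}(S_d)/√d, where f and Q̃_n are applied entrywise. Then, almost surely, ‖Y^f_d − Y^Q_d‖ → 0 as d → ∞. -/

import Mathlib

open MeasureTheory ProbabilityTheory Filter Matrix Real

/-- Descending singular values: `sVal M i` is the `(i+1)`-st largest singular value of `M`. -/
noncomputable def sVal {d : ℕ} (M : Matrix (Fin d) (Fin d) ℝ) (i : Fin d) : ℝ :=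
  Real.sqrt ((Matrix.isHermitian_mul_conjTranspose_self M).eigenvalues
    (Tuple.sort (Matrix.isHermitian_mul_conjTranspose_self M).eigenvalues i.rev))

/-- The operator norm (largest singular value) of `M`. -/
noncomputable def sOne {d : ℕ} (M : Matrix (Fin d) (Fin d) ℝ) : ℝ := ⨆ i, sVal M i

/-- The score matrix `S_d = W^Q_d (W^K_d)ᵀ / √d`. -/
noncomputable def scoreS {Ω : Type*} (WQ WK : (d : ℕ) → Ω → Fin d → Fin d → ℝ)
    (d : ℕ) (ω : Ω) : Matrix (Fin d) (Fin d) ℝ :=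
  (Real.sqrt d)⁻¹ • (Matrix.of (WQ d ω) * (Matrix.of (WK d ω))ᵀ)

/-- `P_n(x) = Σ_{k=0}^{n−1} x^k / k!`, the degree-`(n−1)` Taylor polynomial of `e^x`. -/
noncomputable def Pn (n : ℕ) (x : ℝ) : ℝ := ∑ k ∈ Finset.range n, x ^ k / (Nat.factorial k)

/-- `f(x) = exp(βx − β²/2) − 1`. -/
noncomputable def fβ (β x : ℝ) : ℝ := Real.exp (β * x - β ^ 2 / 2) - 1

/-- `Q̃_n(x) = e^{−β²/2} (P_n(βx) − E[P_n(βχ)])`, where `χ ~ N(0,1)`. -/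
noncomputable def Qt (β : ℝ) (n : ℕ) (x : ℝ) : ℝ :=
  Real.exp (-β ^ 2 / 2) * (Pn n (β * x) - ∫ t, Pn n (β * t) ∂(gaussianReal 0 1))

/-- `n_d = ⌈c·log d / log log d⌉`. -/
noncomputable def nd (c : ℝ) (d : ℕ) : ℕ := ⌈c * Real.log d / Real.log (Real.log d)⌉₊

theorem abs_exp_sub_Pn_le {t : ℝ} (ht : 1 ≤ t) (n : ℕ) (y : ℝ) :
    |Real.exp y - Pn n y| ≤ Real.exp (t * |y|) / t ^ n := by
  have ht0 : 0 < t := by linarith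
  have key (z : ℝ) : HasSum (fun k : ℕ => z ^ (k + n) / ((k + n).factorial : ℝ))
      (Real.exp z - Pn n z) := by
    have h := NormedSpace.expSeries_div_hasSum_exp (z : ℝ)
    rw [← Real.exp_eq_exp_ℝ] at h
    exact (hasSum_nat_add_iff' n).2 h
  have hb := (key (t * |y|)).div_const (t ^ n)
  have h := (key y).norm_le_of_bounded hb (fun k => by
    rw [norm_div, norm_pow, Real.norm_eq_abs, Real.norm_natCast, div_right_comm]
    gcongr
    rw [le_div_iff₀ (by positivity), mul_pow, mul_comm]
    gcongr
    · omega)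
  rw [Real.norm_eq_abs] at h
  refine h.trans ?_
  gcongr
  have : 0 ≤ Pn n (t * |y|) := Finset.sum_nonneg fun k _ => by positivity
  linarith

theorem integrable_exp_mul_abs_gaussianReal {a : ℝ} :
    Integrable (fun x => Real.exp (a * |x|)) (gaussianReal 0 1) := by
  refine Integrable.mono' ((integrable_exp_mul_gaussianReal a).add
    (integrable_exp_mul_gaussianReal (-a))) (by fun_prop) (ae_of_all _ fun x => ?_)
  simp only [Real.norm_eq_abs, Real.abs_exp, Pi.add_apply]
  rcases abs_cases x with ⟨h, _⟩ | ⟨h, _⟩ <;> rw [h]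
  · linarith [Real.exp_pos (-a * x)]
  · rw [mul_neg, ← neg_mul]; linarith [Real.exp_pos (a * x)]

theorem integral_exp_mul_gaussianReal (a : ℝ) :
    ∫ x, Real.exp (a * x) ∂(gaussianReal 0 1) = Real.exp (a ^ 2 / 2) := by
  have := congrFun (mgf_fun_id_gaussianReal (μ := 0) (v := 1)) a
  simpa [mgf] using this

theorem integral_exp_mul_abs_gaussianReal_le (a : ℝ) :
    ∫ x, Real.exp (a * |x|) ∂(gaussianReal 0 1) ≤ 2 * Real.exp (a ^ 2 / 2) := by
  calc _ ≤ ∫ x, (Real.exp (a * x) + Real.exp (-a * x)) ∂(gaussianReal 0 1) := by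
        refine integral_mono integrable_exp_mul_abs_gaussianReal
          ((integrable_exp_mul_gaussianReal a).add (integrable_exp_mul_gaussianReal (-a)))
          fun x => ?_
        rcases abs_cases x with ⟨h, _⟩ | ⟨h, _⟩ <;> simp only [h]
        · linarith [Real.exp_pos (-a * x)]
        · rw [mul_neg, ← neg_mul]; linarith [Real.exp_pos (a * x)]
    _ = _ := by
        rw [integral_add (integrable_exp_mul_gaussianReal a) (integrable_exp_mul_gaussianReal (-a)),
          integral_exp_mul_gaussianReal, integral_exp_mul_gaussianReal, neg_sq]
        ring

theorem measurable_Pn (n : ℕ) : Measurable (Pn n) := by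
  unfold Pn; fun_prop

theorem abs_fβ_sub_Qt_le {β t : ℝ} (hβ : 0 < β) (ht : 1 ≤ t) (n : ℕ) (x : ℝ) :
    |fβ β x - Qt β n x| ≤
      (Real.exp (t * β * |x|) + 2 * Real.exp ((t * β) ^ 2 / 2)) / t ^ n := by
  have ht0 : 0 < t := by linarith
  have hR (y : ℝ) : |Real.exp (β * y) - Pn n (β * y)| ≤ Real.exp (t * β * |y|) / t ^ n := by
    have := abs_exp_sub_Pn_le ht n (β * y)
    rwa [abs_mul, abs_of_pos hβ, ← mul_assoc] at this
  have hbi : Integrable (fun y => Real.exp (t * β * |y|) / t ^ n) (gaussianReal 0 1) :=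
    integrable_exp_mul_abs_gaussianReal.div_const _
  have hmeas := measurable_Pn n
  have hRi : Integrable (fun y => Real.exp (β * y) - Pn n (β * y)) (gaussianReal 0 1) :=
    hbi.mono' (by fun_prop) (ae_of_all _ hR)
  have hPi : Integrable (fun y => Pn n (β * y)) (gaussianReal 0 1) := by
    refine ((integrable_exp_mul_gaussianReal β).sub hRi).congr (ae_of_all _ fun y => ?_)
    simp
  have hI : ∫ y, (Real.exp (β * y) - Pn n (β * y)) ∂(gaussianReal 0 1) =
      Real.exp (β ^ 2 / 2) - ∫ y, Pn n (β * y) ∂(gaussianReal 0 1) := by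
    rw [integral_sub (integrable_exp_mul_gaussianReal β) hPi, integral_exp_mul_gaussianReal]
  have hIle : |∫ y, (Real.exp (β * y) - Pn n (β * y)) ∂(gaussianReal 0 1)| ≤
      2 * Real.exp ((t * β) ^ 2 / 2) / t ^ n := by
    rw [← Real.norm_eq_abs]
    refine (norm_integral_le_of_norm_le hbi (ae_of_all _ fun y => hR y)).trans ?_
    rw [integral_div]
    gcongr
    exact integral_exp_mul_abs_gaussianReal_le _
  have heq : fβ β x - Qt β n x = Real.exp (-β ^ 2 / 2) * ((Real.exp (β * x) - Pn n (β * x)) -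
      ∫ y, (Real.exp (β * y) - Pn n (β * y)) ∂(gaussianReal 0 1)) := by
    rw [hI, fβ, Qt, show β * x - β ^ 2 / 2 = -β ^ 2 / 2 + β * x by ring, Real.exp_add]
    have : Real.exp (-β ^ 2 / 2) * Real.exp (β ^ 2 / 2) = 1 := by
      rw [← Real.exp_add]; ring_nf; simp
    linear_combination this
  rw [heq, abs_mul, Real.abs_exp]
  calc _ ≤ 1 * (Real.exp (t * β * |x|) / t ^ n + 2 * Real.exp ((t * β) ^ 2 / 2) / t ^ n) := by
        gcongr
        · rw [Real.exp_le_one_iff]; nlinarith [sq_nonneg β]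
        · exact (abs_sub _ _).trans (add_le_add (hR x) hIle)
    _ = _ := by ring

theorem sOne_nonneg {d : ℕ} (M : Matrix (Fin d) (Fin d) ℝ) : 0 ≤ sOne M :=
  Real.iSup_nonneg fun _ => Real.sqrt_nonneg _

theorem sOne_le_of_abs_le {d : ℕ} {M : Matrix (Fin d) (Fin d) ℝ} {B : ℝ} (hB : 0 ≤ B)
    (h : ∀ i j, |M i j| ≤ B) : sOne M ≤ d * B := by
  refine Real.iSup_le (fun i => ?_) (by positivity)
  refine Real.sqrt_le_iff.2 ⟨by positivity, ?_⟩
  have hpos := (Matrix.posSemidef_self_mul_conjTranspose M).eigenvalues_nonneg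
  have htr := (Matrix.isHermitian_mul_conjTranspose_self M).trace_eq_sum_eigenvalues
  refine (Finset.single_le_sum (fun k _ => hpos k) (Finset.mem_univ _)).trans ?_
  have htr' : ∑ k, (Matrix.isHermitian_mul_conjTranspose_self M).eigenvalues k =
      ∑ k, ∑ l, M k l * M k l := by
    simpa [Matrix.trace, Matrix.mul_apply] using htr.symm
  rw [htr']
  calc _ ≤ ∑ k : Fin d, ∑ l : Fin d, B * B := by
        refine Finset.sum_le_sum fun k _ => Finset.sum_le_sum fun l _ => ?_
        rw [← abs_mul_abs_self]
        exact mul_self_le_mul_self (abs_nonneg _) (h k l)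
    _ = _ := by simp; ring

theorem integral_exp_sq_gaussianReal {s : ℝ} (hs : s < 1) :
    ∫ x, Real.exp (s * x ^ 2 / 2) ∂(gaussianReal 0 1) = (√(1 - s))⁻¹ := by
  rw [integral_gaussianReal_eq_integral_smul one_ne_zero]
  have h (x : ℝ) : gaussianPDFReal 0 1 x • Real.exp (s * x ^ 2 / 2) =
      (√(2 * π))⁻¹ * Real.exp (-((1 - s) / 2) * x ^ 2) := by
    simp only [gaussianPDFReal, NNReal.coe_one, mul_one, sub_zero, smul_eq_mul]
    rw [mul_assoc, ← Real.exp_add]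
    ring_nf
  simp_rw [h]
  rw [integral_const_mul, integral_gaussian, ← Real.sqrt_inv, ← Real.sqrt_inv,
    ← Real.sqrt_mul (by positivity)]
  congr 1
  have : 1 - s ≠ 0 := by linarith
  field_simp

theorem inv_sqrt_one_sub_le_exp {s : ℝ} (hs0 : 0 ≤ s) (hs : s ≤ 1 / 2) :
    (√(1 - s))⁻¹ ≤ Real.exp s := by
  have h0 : 0 < 1 - s := by linarith
  rw [inv_le_iff_one_le_mul₀ (by positivity)]
  refine le_of_sq_le_sq ?_ (by positivity)
  rw [mul_pow, Real.sq_sqrt h0.le, ← Real.exp_nat_mul]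
  have := Real.add_one_le_exp ((2 : ℕ) * s)
  push_cast at *
  nlinarith

theorem lintegral_exp_sum_mul_le {d : ℕ} {m : ℝ} (hm : m ^ 2 ≤ 1 / 2) :
    ∫⁻ x : Fin d → ℝ, ∫⁻ y : Fin d → ℝ, ENNReal.ofReal (Real.exp (m * ∑ k, x k * y k))
      ∂(Measure.pi fun _ => gaussianReal 0 1) ∂(Measure.pi fun _ => gaussianReal 0 1) ≤
      ENNReal.ofReal (Real.exp (m ^ 2 * d)) := by
  have h1 (x : Fin d → ℝ) :
      ∫⁻ y : Fin d → ℝ, ENNReal.ofReal (Real.exp (m * ∑ k, x k * y k))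
        ∂(Measure.pi fun _ => gaussianReal 0 1) =
      ENNReal.ofReal (∏ k, Real.exp (m ^ 2 * x k ^ 2 / 2)) := by
    have h (y : Fin d → ℝ) : Real.exp (m * ∑ k, x k * y k) =
        ∏ k, Real.exp ((m * x k) * y k) := by
      rw [← Real.exp_sum, Finset.mul_sum]
      simp_rw [mul_assoc]
    simp_rw [h]
    rw [← ofReal_integral_eq_lintegral_ofReal
      (Integrable.fintype_prod fun k => integrable_exp_mul_gaussianReal (m * x k))
      (ae_of_all _ fun y => Finset.prod_nonneg fun k _ => (Real.exp_pos _).le),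
      integral_fintype_prod_eq_prod (fun k y => Real.exp (m * x k * y))]
    simp_rw [integral_exp_mul_gaussianReal, mul_pow]
  have hsq := integral_exp_sq_gaussianReal (s := m ^ 2) (by linarith)
  have hi : Integrable (fun x => Real.exp (m ^ 2 * x ^ 2 / 2)) (gaussianReal 0 1) := by
    refine Integrable.of_integral_ne_zero ?_
    have : 0 < 1 - m ^ 2 := by linarith
    rw [hsq]
    positivity
  simp_rw [h1]
  rw [← ofReal_integral_eq_lintegral_ofReal (Integrable.fintype_prod fun k => hi)
      (ae_of_all _ fun y => Finset.prod_nonneg fun k _ => (Real.exp_pos _).le),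
      integral_fintype_prod_eq_prod (fun _ y => Real.exp (m ^ 2 * y ^ 2 / 2)), hsq]
  refine ENNReal.ofReal_le_ofReal ?_
  simp only [Finset.prod_const, Finset.card_univ, Fintype.card_fin]
  rw [mul_comm (m ^ 2), Real.exp_nat_mul]
  gcongr
  exact inv_sqrt_one_sub_le_exp (sq_nonneg m) hm

theorem scoreS_apply {Ω : Type*} {WQ WK : (d : ℕ) → Ω → Fin d → Fin d → ℝ} {d : ℕ} (ω : Ω)
    (i j : Fin d) :
    scoreS WQ WK d ω i j = (√d)⁻¹ * ∑ k, WQ d ω i k * WK d ω j k := by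
  simp [scoreS, Matrix.mul_apply]

section Score

variable {Ω : Type*} [MeasurableSpace Ω] {P : Measure Ω}
  {WQ WK : (d : ℕ) → Ω → Fin d → Fin d → ℝ} {d : ℕ}

theorem lintegral_exp_mul_scoreS_le
    (hlaw : Measure.map (fun ω => (WQ d ω, WK d ω)) P =
      (Measure.pi fun _ : Fin d => Measure.pi fun _ : Fin d => gaussianReal 0 1).prod
        (Measure.pi fun _ : Fin d => Measure.pi fun _ : Fin d => gaussianReal 0 1))
    {l : ℝ} (hl : l ^ 2 ≤ d / 2) (i j : Fin d) :
    ∫⁻ ω, ENNReal.ofReal (Real.exp (l * scoreS WQ WK d ω i j)) ∂P ≤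
      ENNReal.ofReal (Real.exp (l ^ 2)) := by
  have hd : (0 : ℝ) < d := by exact_mod_cast i.pos
  have hae : AEMeasurable (fun ω => (WQ d ω, WK d ω)) P :=
    aemeasurable_of_map_neZero (by rw [hlaw]; infer_instance)
  set m : ℝ := l * (√d)⁻¹ with hmdef
  have hm2 : m ^ 2 = l ^ 2 / d := by
    rw [hmdef, mul_pow, inv_pow, Real.sq_sqrt hd.le]; rfl
  let G : (Fin d → ℝ) → (Fin d → ℝ) → ENNReal :=
    fun x y => ENNReal.ofReal (Real.exp (m * ∑ k, x k * y k))
  have hG : Measurable (Function.uncurry G) := by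
    simp only [G, Function.uncurry_def]; fun_prop
  have e1 : ∫⁻ ω, ENNReal.ofReal (Real.exp (l * scoreS WQ WK d ω i j)) ∂P =
      ∫⁻ ω, (fun p : (Fin d → Fin d → ℝ) × (Fin d → Fin d → ℝ) => G (p.1 i) (p.2 j))
        (WQ d ω, WK d ω) ∂P := by
    simp only [G, scoreS_apply, hmdef, mul_assoc]
  have hG' : Measurable
      (fun p : (Fin d → Fin d → ℝ) × (Fin d → Fin d → ℝ) => G (p.1 i) (p.2 j)) := by
    simp only [G]; fun_prop
  rw [e1, ← lintegral_map' hG'.aemeasurable hae, hlaw, lintegral_prod _ hG'.aemeasurable]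
  let γ : Measure (Fin d → ℝ) := Measure.pi fun _ => gaussianReal 0 1
  have hin (x : Fin d → ℝ) : ∫⁻ v : Fin d → Fin d → ℝ, G x (v j) ∂(Measure.pi fun _ => γ) =
      ∫⁻ y, G x y ∂γ :=
    (measurePreserving_eval (fun _ : Fin d => γ) j).lintegral_comp (hG.of_uncurry_left)
  have hout : ∫⁻ w : Fin d → Fin d → ℝ, (∫⁻ y, G (w i) y ∂γ) ∂(Measure.pi fun _ => γ) =
      ∫⁻ x, ∫⁻ y, G x y ∂γ ∂γ :=
    (measurePreserving_eval (fun _ : Fin d => γ) i).lintegral_comp (hG.lintegral_prod_right')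
  simp only [γ] at hin hout
  simp_rw [hin]
  rw [hout]
  refine (lintegral_exp_sum_mul_le ?_).trans_eq ?_
  · rw [hm2, div_le_iff₀ hd]; linarith
  · rw [hm2, div_mul_cancel₀ _ hd.ne']

theorem measure_le_mul_scoreS_le
    (hlaw : Measure.map (fun ω => (WQ d ω, WK d ω)) P =
      (Measure.pi fun _ : Fin d => Measure.pi fun _ : Fin d => gaussianReal 0 1).prod
        (Measure.pi fun _ : Fin d => Measure.pi fun _ : Fin d => gaussianReal 0 1))
    {l : ℝ} (hl : l ^ 2 ≤ d / 2) (a : ℝ) (i j : Fin d) :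
    P {ω | a ≤ l * scoreS WQ WK d ω i j} ≤ ENNReal.ofReal (Real.exp (l ^ 2 - a)) := by
  have hae : AEMeasurable (fun ω => (WQ d ω, WK d ω)) P :=
    aemeasurable_of_map_neZero (by rw [hlaw]; infer_instance)
  have hm : AEMeasurable (fun ω => ENNReal.ofReal (Real.exp (l * scoreS WQ WK d ω i j))) P := by
    have h (k : Fin d) : AEMeasurable (fun ω => WQ d ω i k * WK d ω j k) P := by
      have hQ : Measurable fun p : (Fin d → Fin d → ℝ) × (Fin d → Fin d → ℝ) =>
          p.1 i k * p.2 j k := by fun_prop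
      exact hQ.comp_aemeasurable hae
    simp_rw [scoreS_apply]
    fun_prop
  have hsub : {ω | a ≤ l * scoreS WQ WK d ω i j} ⊆
      {ω | ENNReal.ofReal (Real.exp a) ≤
        ENNReal.ofReal (Real.exp (l * scoreS WQ WK d ω i j))} := fun ω hω =>
    ENNReal.ofReal_le_ofReal (Real.exp_le_exp.2 hω)
  refine (measure_mono hsub).trans ((meas_ge_le_lintegral_div hm ?_ ENNReal.ofReal_ne_top).trans ?_)
  · simp [Real.exp_pos]
  · rw [Real.exp_sub, ENNReal.ofReal_div_of_pos (Real.exp_pos a)]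
    gcongr
    exact lintegral_exp_mul_scoreS_le hlaw hl i j

theorem measure_exists_le_abs_scoreS_le
    (hlaw : Measure.map (fun ω => (WQ d ω, WK d ω)) P =
      (Measure.pi fun _ : Fin d => Measure.pi fun _ : Fin d => gaussianReal 0 1).prod
        (Measure.pi fun _ : Fin d => Measure.pi fun _ : Fin d => gaussianReal 0 1))
    {l : ℝ} (hl : l ^ 2 ≤ d / 2) (a : ℝ) :
    P {ω | ∃ i j, a ≤ l * |scoreS WQ WK d ω i j|} ≤
      ENNReal.ofReal (d ^ 2 * (2 * Real.exp (l ^ 2 - a))) := by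
  have hsub : {ω | ∃ i j, a ≤ l * |scoreS WQ WK d ω i j|} ⊆
      ⋃ i : Fin d, ⋃ j : Fin d, {ω | a ≤ l * scoreS WQ WK d ω i j} ∪
        {ω | a ≤ (-l) * scoreS WQ WK d ω i j} := by
    rintro ω ⟨i, j, h⟩
    simp only [Set.mem_iUnion]
    refine ⟨i, j, ?_⟩
    rcases abs_cases (scoreS WQ WK d ω i j) with ⟨e, _⟩ | ⟨e, _⟩ <;> rw [e] at h
    · exact Or.inl h
    · exact Or.inr (by simpa using h)
  have hij (i j : Fin d) : P ({ω | a ≤ l * scoreS WQ WK d ω i j} ∪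
        {ω | a ≤ (-l) * scoreS WQ WK d ω i j}) ≤ ENNReal.ofReal (2 * Real.exp (l ^ 2 - a)) := by
    refine (measure_union_le _ _).trans ?_
    rw [two_mul, ENNReal.ofReal_add (Real.exp_pos _).le (Real.exp_pos _).le]
    refine add_le_add (measure_le_mul_scoreS_le hlaw hl a i j) ?_
    simpa using measure_le_mul_scoreS_le hlaw (l := -l) (by simpa using hl) a i j
  refine (measure_mono hsub).trans ?_
  calc _ ≤ ∑ i : Fin d, ∑ j : Fin d, ENNReal.ofReal (2 * Real.exp (l ^ 2 - a)) :=
        (measure_iUnion_fintype_le _ _).trans (Finset.sum_le_sum fun i _ =>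
          (measure_iUnion_fintype_le _ _).trans (Finset.sum_le_sum fun j _ => hij i j))
    _ = _ := by
        rw [ENNReal.ofReal_mul (p := (d : ℝ) ^ 2) (by positivity),
          ENNReal.ofReal_pow (by positivity), ENNReal.ofReal_natCast]
        simp [sq, mul_assoc]

end Score

theorem ae_eventually_abs_scoreS_lt {Ω : Type*} [MeasurableSpace Ω] {P : Measure Ω}
    {WQ WK : (d : ℕ) → Ω → Fin d → Fin d → ℝ}
    (hlaw : ∀ d : ℕ, Measure.map (fun ω => (WQ d ω, WK d ω)) P =
      (Measure.pi fun _ : Fin d => Measure.pi fun _ : Fin d => gaussianReal 0 1).prod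
        (Measure.pi fun _ : Fin d => Measure.pi fun _ : Fin d => gaussianReal 0 1)) :
    ∀ᵐ ω ∂P, ∀ᶠ d : ℕ in atTop, ∀ i j,
      √(Real.log d) * |scoreS WQ WK d ω i j| < 5 * Real.log d := by
  have hbound (d : ℕ) :
      P {ω | ∃ i j, 5 * Real.log d ≤ √(Real.log d) * |scoreS WQ WK d ω i j|} ≤
        ENNReal.ofReal (2 * ((d : ℝ) ^ 2)⁻¹) := by
    rcases Nat.eq_zero_or_pos d with rfl | hd
    · simp
    have hd' : (1 : ℝ) ≤ d := by exact_mod_cast hd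
    have hlog : 0 ≤ Real.log d := Real.log_nonneg hd'
    have hle : Real.log d ≤ d / 2 := by
      have h1 := Real.log_le_sub_one_of_pos (x := (d : ℝ) / 2) (by positivity)
      rw [Real.log_div (by positivity) two_ne_zero] at h1
      linarith [Real.log_two_lt_d9]
    refine (measure_exists_le_abs_scoreS_le (hlaw d) (by rwa [Real.sq_sqrt hlog]) _).trans_eq ?_
    rw [Real.sq_sqrt hlog, show Real.log d - 5 * Real.log d = -((4 : ℕ) * Real.log d) by
      push_cast; ring, Real.exp_neg, Real.exp_nat_mul, Real.exp_log (by positivity)]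
    congr 1
    field_simp
  have hsum : Summable fun d : ℕ => 2 * ((d : ℝ) ^ 2)⁻¹ :=
    (Real.summable_nat_pow_inv.2 one_lt_two).mul_left 2
  have hfin : ∑' d : ℕ, P {ω | ∃ i j, 5 * Real.log d ≤ √(Real.log d) * |scoreS WQ WK d ω i j|}
      ≠ ⊤ := ne_top_of_le_ne_top hsum.tsum_ofReal_ne_top (ENNReal.tsum_le_tsum hbound)
  filter_upwards [ae_eventually_notMem hfin] with ω hω
  filter_upwards [hω] with d hd i j
  by_contra! h
  exact hd ⟨i, j, h⟩

theorem exp_le_pow_nd {c L η ε : ℝ} {d : ℕ} (hL : L = Real.log d) (hL1 : 1 ≤ L)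
    (hlog : 1 ≤ Real.log L) (hε : 0 < ε) (hη : η ≤ 1 / 2)
    (h : -Real.log ε ≤ η * Real.log L) :
    Real.exp (c * (1 / 2 - η) * L) ≤ (ε * √L) ^ nd c d := by
  have hL0 : 0 < L := by linarith
  have ht : (1 / 2 - η) * Real.log L ≤ Real.log (ε * √L) := by
    rw [Real.log_mul hε.ne' (by positivity), Real.log_sqrt hL0.le]
    linarith
  have hn : c * L / Real.log L ≤ nd c d := by
    rw [hL]; exact Nat.le_ceil _
  have htpos : 0 < ε * √L := by positivity
  rw [← Real.exp_log (pow_pos htpos _), Real.log_pow, Real.exp_le_exp]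
  have h0 : 0 ≤ (1 / 2 - η) * Real.log L := mul_nonneg (by linarith) (by linarith)
  calc c * (1 / 2 - η) * L = c * L / Real.log L * ((1 / 2 - η) * Real.log L) := by
        field_simp
    _ ≤ nd c d * ((1 / 2 - η) * Real.log L) := by gcongr
    _ ≤ _ := by gcongr

theorem sOne_sub_le {β c ε η κ : ℝ} {d : ℕ} {S : Matrix (Fin d) (Fin d) ℝ} (hβ : 0 < β)
    (hε : 0 < ε) (hε1 : ε ≤ 1) (hεκ : ε * (5 * β + β ^ 2 / 2) ≤ κ / 4)
    (hη : η ≤ 1 / 2) (hc : 1 / 2 + 3 * κ / 8 ≤ c * (1 / 2 - η))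
    (hL1 : 1 ≤ Real.log d) (hlog : 1 ≤ Real.log (Real.log d))
    (h : -Real.log ε ≤ η * Real.log (Real.log d))
    (hS : ∀ i j, √(Real.log d) * |S i j| < 5 * Real.log d) :
    sOne ((√d)⁻¹ • (Matrix.of fun i j => fβ β (S i j)) -
      (√d)⁻¹ • (Matrix.of fun i j => Qt β (nd c d) (S i j))) ≤
      3 * Real.exp (-(κ / 8) * Real.log d) := by
  have hpow := exp_le_pow_nd (c := c) rfl hL1 hlog hε hη h
  set L := Real.log d with hL
  have hL0 : 0 < L := by linarith
  have hd : (0 : ℝ) < d := by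
    rcases Nat.eq_zero_or_pos d with rfl | h0
    · simp [hL] at hL0
    · exact_mod_cast h0
  have ht1 : 1 ≤ ε * √L := by
    have h1 : 0 ≤ Real.log (ε * √L) := by
      rw [Real.log_mul hε.ne' (by positivity), Real.log_sqrt hL0.le]
      nlinarith
    exact (Real.log_nonneg_iff (by positivity)).1 h1
  have hε2 : ε ^ 2 ≤ ε := by nlinarith
  have hexp : 3 * Real.exp (κ / 4 * L) / (ε * √L) ^ nd c d ≤
      3 * Real.exp (-(1 / 2 + κ / 8) * L) := by
    rw [div_le_iff₀ (by positivity)]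
    calc _ = 3 * Real.exp (-(1 / 2 + κ / 8) * L) * Real.exp ((1 / 2 + 3 * κ / 8) * L) := by
          rw [mul_assoc, ← Real.exp_add]; ring_nf
      _ ≤ 3 * Real.exp (-(1 / 2 + κ / 8) * L) * Real.exp (c * (1 / 2 - η) * L) := by gcongr
      _ ≤ _ := by gcongr
  have hsqrt : √(d : ℝ) = Real.exp (1 / 2 * L) := by
    rw [Real.sqrt_eq_rpow, Real.rpow_def_of_pos hd, ← hL, mul_comm]
  have hentry (i j : Fin d) : |fβ β (S i j) - Qt β (nd c d) (S i j)| ≤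
      3 * Real.exp (-(1 / 2 + κ / 8) * L) := by
    refine (abs_fβ_sub_Qt_le hβ ht1 _ _).trans (le_trans ?_ hexp)
    gcongr
    have e1 : ε * √L * β * |S i j| ≤ κ / 4 * L := by
      calc _ = ε * β * (√L * |S i j|) := by ring
        _ ≤ ε * β * (5 * L) := mul_le_mul_of_nonneg_left (hS i j).le (by positivity)
        _ = ε * (5 * β) * L := by ring
        _ ≤ κ / 4 * L := by
          gcongr
          refine le_trans ?_ hεκ
          gcongr
          nlinarith
    have e2 : (ε * √L * β) ^ 2 / 2 ≤ κ / 4 * L := by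
      calc _ = ε ^ 2 * (β ^ 2 / 2) * L := by
            rw [mul_pow, mul_pow, Real.sq_sqrt hL0.le]; ring
        _ ≤ ε * (β ^ 2 / 2) * L := by gcongr
        _ ≤ κ / 4 * L := by
          gcongr
          refine le_trans ?_ hεκ
          gcongr
          nlinarith
    linarith [Real.exp_le_exp.2 e1, Real.exp_le_exp.2 e2]
  refine (sOne_le_of_abs_le (B := (√d)⁻¹ * (3 * Real.exp (-(1 / 2 + κ / 8) * L)))
    (by positivity) fun i j => ?_).trans_eq ?_
  · simp only [Matrix.sub_apply, Matrix.smul_apply, Matrix.of_apply, smul_eq_mul]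
    rw [← mul_sub, abs_mul, abs_of_nonneg (by positivity)]
    gcongr
    exact hentry i j
  · rw [← mul_assoc, ← div_eq_mul_inv, Real.div_sqrt, hsqrt, mul_left_comm, ← Real.exp_add]
    ring_nf

/-- Fix `β > 0`, `δ ∈ (0,1/2)` and `c > 1/(1−2δ)`. With
`Y^f_d = f(S_d)/√d` and `Y^Q_d = Q̃_{n_d}(S_d)/√d` (applied entrywise), almost surely
`‖Y^f_d − Y^Q_d‖ → 0` as `d → ∞`. -/
theorem stmt5 {Ω : Type*} [MeasurableSpace Ω] (P : Measure Ω) [IsProbabilityMeasure P]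
    (β δ c : ℝ) (hβ : 0 < β) (hδ : 0 < δ) (hδ' : δ < 1 / 2) (hc : 1 / (1 - 2 * δ) < c)
    (WQ WK : (d : ℕ) → Ω → Fin d → Fin d → ℝ)
    (hlaw : ∀ d : ℕ, Measure.map (fun ω => (WQ d ω, WK d ω)) P =
      (Measure.pi fun _ : Fin d => Measure.pi fun _ : Fin d => gaussianReal 0 1).prod
        (Measure.pi fun _ : Fin d => Measure.pi fun _ : Fin d => gaussianReal 0 1)) :
    ∀ᵐ ω ∂P,
      Tendsto (fun d : ℕ => sOne
          ((Real.sqrt d)⁻¹ • (Matrix.of fun i j : Fin d => fβ β (scoreS WQ WK d ω i j)) -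
           (Real.sqrt d)⁻¹ • (Matrix.of fun i j : Fin d => Qt β (nd c d) (scoreS WQ WK d ω i j))))
        atTop (nhds 0) := by
  have hc1 : 1 < c := by
    refine lt_of_le_of_lt ?_ hc
    rw [le_div_iff₀ (by linarith)]
    linarith
  obtain ⟨κ, hκ, rfl⟩ : ∃ κ, 0 < κ ∧ c = 1 + κ := ⟨c - 1, by linarith, by ring⟩
  let ε : ℝ := min 1 (κ / 4 / (5 * β + β ^ 2 / 2))
  have hε : 0 < ε := lt_min one_pos (by positivity)
  have hεκ : ε * (5 * β + β ^ 2 / 2) ≤ κ / 4 :=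
    (le_div_iff₀ (by positivity)).1 (min_le_right _ _)
  let η : ℝ := κ / (8 * (1 + κ))
  have hη0 : 0 < η := by positivity
  have hη : η ≤ 1 / 2 := by
    simp only [η]
    rw [div_le_iff₀ (by positivity)]
    linarith
  have hcη : 1 / 2 + 3 * κ / 8 ≤ (1 + κ) * (1 / 2 - η) := by
    have : (1 + κ) * η = κ / 8 := by simp only [η]; field_simp
    linarith
  have hlog : Tendsto (fun d : ℕ => Real.log d) atTop atTop :=
    Real.tendsto_log_atTop.comp tendsto_natCast_atTop_atTop
  have hloglog := Real.tendsto_log_atTop.comp hlog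
  have hlim : Tendsto (fun d : ℕ => 3 * Real.exp (-(κ / 8) * Real.log d)) atTop (nhds 0) := by
    have := (Real.tendsto_exp_atBot.comp
      (hlog.const_mul_atTop_of_neg (r := -(κ / 8)) (by linarith))).const_mul 3
    simpa using this
  filter_upwards [ae_eventually_abs_scoreS_lt hlaw] with ω hω
  refine squeeze_zero' (Eventually.of_forall fun d => sOne_nonneg _) ?_ hlim
  filter_upwards [hω, hlog.eventually_ge_atTop 1, hloglog.eventually_ge_atTop 1,
    (hloglog.const_mul_atTop hη0).eventually_ge_atTop (-Real.log ε)] with d hd h1 h2 h3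
  exact sOne_sub_le hβ hε (min_le_left _ _) hεκ hη hcη h1 h2 h3 hd
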